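/- A polynomial p(x_1,...,x_r,y_1,...,y_s) that is symmetric in the x-variables and symmetric in the y-variables is supersymmetric (i.e., the substitution x_r = t, y_1 = −t yields a polynomial independent of t) if and only if p is in the ℂ-subalgebra generated by the power sum supersymmetric polynomials p_k = x_1^k + ... + x_r^k + (−1)^{k+1}(y_1^k + ... + y_s^k), k ≥ 0. -/

import Mathlib

open MvPolynomial

/-- The substitution `x_r ↦ t`, `y_1 ↦ −t` (leaving all other variables fixed), on polynomials
in variables `x_1, …, x_{r+1}, y_1, …, y_{s+1}` (the `x`'s indexed by `Fin (r+1)` via `Sum.inl`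
and the `y`'s indexed by `Fin (s+1)` via `Sum.inr`). -/
noncomputable def cancelSub (r s : ℕ) (t : ℂ) :
    MvPolynomial (Fin (r + 1) ⊕ Fin (s + 1)) ℂ →ₐ[ℂ]
      MvPolynomial (Fin (r + 1) ⊕ Fin (s + 1)) ℂ :=
  MvPolynomial.aeval fun i =>
    if i = Sum.inl (Fin.last r) then MvPolynomial.C t
    else if i = Sum.inr 0 then MvPolynomial.C (-t)
    else MvPolynomial.X i

/-- A polynomial in `x_1, …, x_{r+1}, y_1, …, y_{s+1}` is supersymmetric if it is symmetric
in the `x`-variables, symmetric in the `y`-variables, and the substitution of the last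
`x`-variable by `t` and the first `y`-variable by `−t` yields a result independent of `t`. -/
def IsSupersymmetric (r s : ℕ) (p : MvPolynomial (Fin (r + 1) ⊕ Fin (s + 1)) ℂ) : Prop :=
  (∀ σ : Equiv.Perm (Fin (r + 1)),
      MvPolynomial.rename (Sum.map (σ : Fin (r + 1) → Fin (r + 1)) id) p = p) ∧
  (∀ τ : Equiv.Perm (Fin (s + 1)),
      MvPolynomial.rename (Sum.map id (τ : Fin (s + 1) → Fin (s + 1))) p = p) ∧
  (∀ t t' : ℂ, cancelSub r s t p = cancelSub r s t' p)

/-- The `k`-th power sum supersymmetric polynomial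
`p_k = x_1^k + ⋯ + x_{r+1}^k + (−1)^{k+1} (y_1^k + ⋯ + y_{s+1}^k)`. -/
noncomputable def powerSumSupersym (r s : ℕ) (k : ℕ) :
    MvPolynomial (Fin (r + 1) ⊕ Fin (s + 1)) ℂ :=
  (∑ i : Fin (r + 1), MvPolynomial.X (Sum.inl i) ^ k) +
    (-1 : MvPolynomial (Fin (r + 1) ⊕ Fin (s + 1)) ℂ) ^ (k + 1) *
      ∑ j : Fin (s + 1), MvPolynomial.X (Sum.inr j) ^ k


section key
variable {R : Type*} [CommRing R]

/-- The geometric series. -/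
noncomputable def geomS (y : R) : PowerSeries R := PowerSeries.mk fun k => y ^ k

lemma geomS_mul (y : R) : (1 - PowerSeries.C y * PowerSeries.X) * geomS y = 1 := by
  ext k
  rw [sub_mul, one_mul, mul_assoc, map_sub, PowerSeries.coeff_C_mul]
  cases k with
  | zero => simp [geomS]
  | succ k => simp [geomS, PowerSeries.coeff_succ_X_mul, PowerSeries.coeff_one, pow_succ']

lemma coeff_prod_geomS {ι : Type*} (s : Finset ι) (x : ι → R) (y : R) (l : ℕ) :
    PowerSeries.coeff (s.card + l)
      ((∏ i ∈ s, (1 - PowerSeries.C (x i) * PowerSeries.X)) * geomS y) =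
      y ^ l * ∏ i ∈ s, (y - x i) := by
  classical
  induction s using Finset.induction_on generalizing l with
  | empty => simp [geomS]
  | insert a s ha ih =>
    rw [Finset.prod_insert ha, Finset.prod_insert ha, Finset.card_insert_of_notMem ha]
    have h1 := ih l
    have h2 := ih (l + 1)
    rw [mul_assoc, sub_mul, one_mul, mul_assoc, map_sub, PowerSeries.coeff_C_mul,
      show s.card + 1 + l = (s.card + l) + 1 by ring, PowerSeries.coeff_succ_X_mul, h1,
      show s.card + l + 1 = s.card + (l + 1) by ring, h2]
    ring

lemma deriv_prod {ι : Type*} (s : Finset ι) (x : ι → R) :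
    PowerSeries.derivative R (∏ i ∈ s, (1 - PowerSeries.C (x i) * PowerSeries.X)) =
      - ((∏ i ∈ s, (1 - PowerSeries.C (x i) * PowerSeries.X)) *
        PowerSeries.mk fun k => ∑ i ∈ s, x i ^ (k + 1)) := by
  classical
  induction s using Finset.induction_on with
  | empty =>
    ext; simp
  | insert a s ha ih =>
    rw [Finset.prod_insert ha, Derivation.leibniz, ih]
    have e1 : PowerSeries.derivative R (1 - PowerSeries.C (x a) * PowerSeries.X : PowerSeries R)
        = - PowerSeries.C (x a) := by
      rw [map_sub, Derivation.leibniz]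
      simp
    have e2 : (PowerSeries.mk fun k => ∑ i ∈ insert a s, x i ^ (k + 1)) =
        PowerSeries.C (x a) * geomS (x a) + PowerSeries.mk fun k => ∑ i ∈ s, x i ^ (k + 1) := by
      ext k
      simp [geomS, Finset.sum_insert ha, pow_succ']
    rw [e1, e2]
    have := geomS_mul (x a)
    simp only [smul_eq_mul]
    linear_combination (PowerSeries.C (x a) *
      ∏ i ∈ s, (1 - PowerSeries.C (x i) * PowerSeries.X)) * this

/-- Existence of the quotient series with coefficients in the algebra of super power sums. -/
lemma exists_series [Algebra ℂ R] {m n : ℕ} (x : Fin m → R) (y : Fin n → R) :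
    ∃ E : PowerSeries R,
      (∏ j, (1 - PowerSeries.C (y j) * PowerSeries.X)) * E =
        ∏ i, (1 - PowerSeries.C (x i) * PowerSeries.X) ∧
      ∀ k, PowerSeries.coeff k E ∈
        Algebra.adjoin ℂ (Set.range fun k : ℕ => ∑ i, x i ^ k - ∑ j, y j ^ k) := by
  set f : PowerSeries R := ∏ i, (1 - PowerSeries.C (x i) * PowerSeries.X) with hf
  set g : PowerSeries R := ∏ j, (1 - PowerSeries.C (y j) * PowerSeries.X) with hg
  set u : PowerSeries R := ∏ j, geomS (y j) with hu
  have hgu : g * u = 1 := by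
    rw [hg, hu, ← Finset.prod_mul_distrib]
    exact Finset.prod_eq_one fun j _ => geomS_mul _
  have hE : g * (u * f) = f := by rw [← mul_assoc, hgu, one_mul]
  refine ⟨u * f, hE, ?_⟩
  set E := u * f with hEdef
  have hd := congrArg (PowerSeries.derivative R) hE
  rw [Derivation.leibniz] at hd
  have hf' : PowerSeries.derivative R f = _ := deriv_prod Finset.univ x
  have hg' : PowerSeries.derivative R g = _ := deriv_prod Finset.univ y
  rw [← hf] at hf'
  rw [← hg] at hg'
  rw [hf', hg'] at hd
  have hE' : PowerSeries.derivative R E = - (E * PowerSeries.mk fun k =>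
      ∑ i, x i ^ (k + 1) - ∑ j, y j ^ (k + 1)) := by
    have e : (PowerSeries.mk fun k => ∑ i, x i ^ (k + 1) - ∑ j, y j ^ (k + 1)) =
      (PowerSeries.mk fun k => ∑ i, x i ^ (k + 1)) - (PowerSeries.mk fun k => ∑ j, y j ^ (k + 1)) := by
      ext; simp
    rw [e]
    simp only [smul_eq_mul] at hd
    rw [← hE] at hd
    generalize (PowerSeries.mk fun k => ∑ i, x i ^ (k + 1)) = P at *
    generalize (PowerSeries.mk fun k => ∑ j, y j ^ (k + 1)) = Q at *
    linear_combination u * hd + (- PowerSeries.derivative R E + E * Q - E * P) * hgu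
  intro k
  induction k using Nat.strong_induction_on with
  | _ k ih =>
    cases k with
    | zero =>
      have : PowerSeries.coeff 0 E = 1 := by
        simp [hEdef, hu, hf, geomS, map_prod]
      rw [this]
      exact one_mem _
    | succ k =>
      have h := congrArg (PowerSeries.coeff k) hE'
      rw [PowerSeries.coeff_derivative, map_neg] at h
      have hmem : PowerSeries.coeff (k + 1) E * ((k : R) + 1) ∈
          Algebra.adjoin ℂ (Set.range fun k : ℕ => ∑ i, x i ^ k - ∑ j, y j ^ k) := by
        rw [h, PowerSeries.coeff_mul]
        refine neg_mem (sum_mem fun p hp => mul_mem (ih _ ?_) ?_)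
        · have := Finset.HasAntidiagonal.mem_antidiagonal.1 hp
          omega
        · rw [PowerSeries.coeff_mk]
          exact Algebra.subset_adjoin ⟨p.2 + 1, rfl⟩
      have : PowerSeries.coeff (k + 1) E =
          ((k + 1 : ℂ)⁻¹) • (PowerSeries.coeff (k + 1) E * ((k : R) + 1)) := by
        have e : ((k : R) + 1) = algebraMap ℂ R (k + 1) := by simp
        rw [e, mul_comm, ← Algebra.smul_def, smul_smul, inv_mul_cancel₀, one_smul]
        exact_mod_cast Nat.succ_ne_zero k
      rw [this]
      exact Subalgebra.smul_mem _ hmem _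

/-- Coefficients of the products omitting one factor. -/
noncomputable def gP {n : ℕ} (y : Fin n → R) (j : Fin n) : Polynomial R :=
  ∏ i ∈ Finset.univ.erase j, (1 - Polynomial.C (y i) * Polynomial.X)

lemma gP_deg {n : ℕ} (y : Fin n → R) (j : Fin n) : (gP y j).natDegree < n := by
  have h1 : (gP y j).natDegree ≤ ∑ i ∈ Finset.univ.erase j, 1 := by
    refine (Polynomial.natDegree_prod_le _ _).trans (Finset.sum_le_sum fun i _ => ?_)
    compute_degree
  have : (Finset.univ.erase j).card = n - 1 := by simp
  have := j.pos
  simp at h1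
  omega

lemma coeff_sum_gP {n : ℕ} (y : Fin n → R) (j : Fin n) (E f : PowerSeries R)
    (h : (∏ j, (1 - PowerSeries.C (y j) * PowerSeries.X)) * E = f) (N : ℕ) :
    ∑ b : Fin n, PowerSeries.coeff N (PowerSeries.X ^ (b : ℕ) * E) * (gP y j).coeff b =
      PowerSeries.coeff N (f * geomS (y j)) := by
  have h1 : ((gP y j : Polynomial R) : PowerSeries R) =
      ∏ i ∈ Finset.univ.erase j, (1 - PowerSeries.C (y i) * PowerSeries.X) := by
    rw [gP, ← Polynomial.coeToPowerSeries.ringHom_apply, map_prod]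
    simp
  have h2 : f * geomS (y j) = (gP y j : PowerSeries R) * E := by
    rw [← h, h1, ← Finset.mul_prod_erase Finset.univ _ (Finset.mem_univ j)]
    linear_combination ((∏ i ∈ Finset.univ.erase j, (1 - PowerSeries.C (y i) * PowerSeries.X))
      * E) * geomS_mul (y j)
  rw [h2]
  conv_rhs => rw [Polynomial.as_sum_range' (gP y j) n (gP_deg y j)]
  rw [← Polynomial.coeToPowerSeries.ringHom_apply, map_sum, Finset.sum_mul, map_sum,
    ← Fin.sum_univ_eq_sum_range (fun b => PowerSeries.coeff N (Polynomial.coeToPowerSeries.ringHom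
      (Polynomial.monomial b ((gP y j).coeff b)) * E))]
  refine Finset.sum_congr rfl fun b _ => ?_
  rw [← Polynomial.C_mul_X_pow_eq_monomial]
  simp only [Polynomial.coeToPowerSeries.ringHom_apply, Polynomial.coe_mul, Polynomial.coe_C,
    Polynomial.coe_pow, Polynomial.coe_X]
  rw [mul_assoc, PowerSeries.coeff_C_mul, mul_comm]

lemma det_gP {n : ℕ} (y : Fin n → R) :
    (Matrix.of fun b j : Fin n => (gP y j).coeff (b : ℕ)).det = (Matrix.vandermonde y).det := by
  set E : PowerSeries R := ∏ j, geomS (y j) with hE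
  have hgu : (∏ j, (1 - PowerSeries.C (y j) * PowerSeries.X)) * E = 1 := by
    rw [hE, ← Finset.prod_mul_distrib]
    exact Finset.prod_eq_one fun j _ => geomS_mul _
  have hmul : (Matrix.of fun a b : Fin n =>
      PowerSeries.coeff (a : ℕ) (PowerSeries.X ^ (b : ℕ) * E)) *
      (Matrix.of fun b j : Fin n => (gP y j).coeff (b : ℕ)) = (Matrix.vandermonde y).transpose := by
    ext a j
    rw [Matrix.mul_apply]
    simp only [Matrix.of_apply]
    rw [coeff_sum_gP y j E 1 hgu]
    simp [geomS, Matrix.vandermonde]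
  have hd := congrArg Matrix.det hmul
  rw [Matrix.det_mul, Matrix.det_transpose, Matrix.det_of_isLowerTriangular] at hd
  · rw [← hd]
    simp [PowerSeries.coeff_X_pow_mul', hE, geomS, map_prod]
  · intro a b hab
    simp only [Matrix.of_apply]
    rw [PowerSeries.coeff_X_pow_mul', if_neg]
    simpa using hab

lemma det_mem [IsDomain R] [Algebra ℂ R] {m n : ℕ} (x : Fin m → R) (y : Fin n → R) (l : Fin n → ℕ) :
    ∃ c ∈ Algebra.adjoin ℂ (Set.range fun k : ℕ => ∑ i, x i ^ k - ∑ j, y j ^ k),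
      (∏ j, ∏ i, (y j - x i)) * (Matrix.of fun a j => y j ^ l a).det =
        c * (Matrix.vandermonde y).det := by
  obtain ⟨E, hE, hmem⟩ := exists_series x y
  refine ⟨(Matrix.of fun a b : Fin n =>
      PowerSeries.coeff (m + l a) (PowerSeries.X ^ (b : ℕ) * E)).det, ?_, ?_⟩
  · rw [Matrix.det_apply]
    refine sum_mem fun σ _ => ?_
    rw [Units.smul_def]
    refine zsmul_mem (prod_mem fun b _ => ?_) _
    simp only [Matrix.of_apply]
    rw [PowerSeries.coeff_X_pow_mul']
    split_ifs
    · exact hmem _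
    · exact zero_mem _
  · rw [← det_gP, ← Matrix.det_mul, ← Matrix.det_mul_row]
    congr 1
    ext a j
    rw [Matrix.mul_apply]
    simp only [Matrix.of_apply]
    rw [coeff_sum_gP y j E _ hE]
    have := coeff_prod_geomS Finset.univ x (y j) (l a)
    rw [Finset.card_univ, Fintype.card_fin] at this
    rw [this, mul_comm]

lemma key_mem [IsDomain R] [Algebra ℂ R] {m n : ℕ} (x : Fin m → R) (y : Fin n → R)
    (hy : Function.Injective y) (v : MvPolynomial (Fin n) ℂ) (hv : v.IsSymmetric) :
    (∏ j, ∏ i, (y j - x i)) * aeval y v ∈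
      Algebra.adjoin ℂ (Set.range fun k : ℕ => ∑ i, x i ^ k - ∑ j, y j ^ k) := by
  classical
  set A := Algebra.adjoin ℂ (Set.range fun k : ℕ => ∑ i, x i ^ k - ∑ j, y j ^ k)
  set D := (∏ j, ∏ i, (y j - x i))
  set V := (Matrix.vandermonde y).det with hV
  have hV0 : V ≠ 0 := Matrix.det_vandermonde_ne_zero_iff.2 hy
  set q : MvPolynomial (Fin n) ℂ := v * (Matrix.vandermonde (X : Fin n → MvPolynomial (Fin n) ℂ)).det
    with hq
  -- antisymmetrisation
  have h1 : ∀ σ : Equiv.Perm (Fin n), aeval (y ∘ σ) q =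
      ((Equiv.Perm.sign σ : ℤ) : R) * (aeval y v * V) := by
    intro σ
    have e1 : aeval (y ∘ σ) v = aeval y v := by
      rw [← aeval_rename, hv σ]
    have e2 : aeval (y ∘ σ) (Matrix.vandermonde (X : Fin n → MvPolynomial (Fin n) ℂ)).det =
        ((Equiv.Perm.sign σ : ℤ) : R) * V := by
      rw [AlgHom.map_det, hV, ← Matrix.det_permute]
      congr 1
      ext a b
      simp [Matrix.vandermonde]
    rw [hq, map_mul, e1, e2]
    ring
  have h2 : ∑ σ : Equiv.Perm (Fin n), ((Equiv.Perm.sign σ : ℤ) : R) * aeval (y ∘ σ) q =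
      (n.factorial : R) * (aeval y v * V) := by
    have : ∀ σ : Equiv.Perm (Fin n), ((Equiv.Perm.sign σ : ℤ) : R) * aeval (y ∘ σ) q =
        aeval y v * V := by
      intro σ
      rw [h1, ← mul_assoc, ← Int.cast_mul, ← Units.val_mul, Int.units_mul_self]
      simp
    rw [Finset.sum_congr rfl fun σ _ => this σ]
    simp [Fintype.card_perm]
  have h3 : ∑ σ : Equiv.Perm (Fin n), ((Equiv.Perm.sign σ : ℤ) : R) * aeval (y ∘ σ) q =
      ∑ l ∈ q.support, algebraMap ℂ R (q.coeff l) * (Matrix.of fun a j => y j ^ l a).det := by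
    have : ∀ σ : Equiv.Perm (Fin n), aeval (y ∘ σ) q =
        ∑ l ∈ q.support, algebraMap ℂ R (q.coeff l) * ∏ i, y (σ i) ^ l i := by
      intro σ
      rw [aeval_def, eval₂_eq']
      rfl
    simp_rw [this, Finset.mul_sum]
    rw [Finset.sum_comm]
    refine Finset.sum_congr rfl fun l _ => ?_
    rw [← Matrix.det_transpose, Matrix.det_apply', Finset.mul_sum]
    refine Finset.sum_congr rfl fun σ _ => ?_
    simp only [Matrix.transpose_apply, Matrix.of_apply]
    ring
  choose c hc hc' using fun l : Fin n → ℕ => det_mem x y l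
  have h4 : (n.factorial : R) * (D * aeval y v) =
      ∑ l ∈ q.support, algebraMap ℂ R (q.coeff l) * c l := by
    apply mul_right_cancel₀ hV0
    calc (n.factorial : R) * (D * aeval y v) * V
        = D * ((n.factorial : R) * (aeval y v * V)) := by ring
      _ = _ := by
        rw [← h2, h3, Finset.mul_sum, Finset.sum_mul]
        refine Finset.sum_congr rfl fun l _ => ?_
        linear_combination algebraMap ℂ R (q.coeff l) * hc' l
  have h5 : D * aeval y v = ((n.factorial : ℂ)⁻¹) • ((n.factorial : R) * (D * aeval y v)) := by
    have e : (n.factorial : R) = algebraMap ℂ R n.factorial := by simp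
    rw [e, ← Algebra.smul_def, smul_smul, inv_mul_cancel₀, one_smul]
    exact_mod_cast n.factorial_ne_zero
  rw [h5, h4]
  exact Subalgebra.smul_mem _ (sum_mem fun l _ => mul_mem (Subalgebra.algebraMap_mem _ _) (hc _)) _

end key

section main

/-- Super power sums for arbitrary numbers of variables. -/
noncomputable def psP (m n k : ℕ) : MvPolynomial (Fin m ⊕ Fin n) ℂ :=
  (∑ i : Fin m, X (Sum.inl i) ^ k) + (-1 : MvPolynomial (Fin m ⊕ Fin n) ℂ) ^ (k + 1) *
      ∑ j : Fin n, X (Sum.inr j) ^ k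

/-- Double symmetry. -/
def DSym {m n : ℕ} (p : MvPolynomial (Fin m ⊕ Fin n) ℂ) : Prop :=
  ∀ (σ : Equiv.Perm (Fin m)) (τ : Equiv.Perm (Fin n)), rename (Sum.map σ τ) p = p

/-- Cancellation, by evaluation. -/
def Cancel {m n : ℕ} (p : MvPolynomial (Fin m ⊕ Fin n) ℂ) : Prop :=
  ∀ (a : Fin m → ℂ) (b : Fin n → ℂ) (i : Fin m) (j : Fin n), a i = - b j →
    eval (Sum.elim a b) p = eval (Sum.elim (Function.update a i 0) (Function.update b j 0)) p

/-- The resultant. -/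
noncomputable def resD (m n : ℕ) : MvPolynomial (Fin m ⊕ Fin n) ℂ :=
  ∏ ij : Fin m × Fin n, (X (Sum.inl ij.1) + X (Sum.inr ij.2))

lemma psP_eq (m n k : ℕ) : psP m n k = ∑ i : Fin m, X (Sum.inl i) ^ k -
    ∑ j : Fin n, (- X (Sum.inr j) : MvPolynomial (Fin m ⊕ Fin n) ℂ) ^ k := by
  rw [psP]
  have : ∀ j : Fin n, (- X (Sum.inr j) : MvPolynomial (Fin m ⊕ Fin n) ℂ) ^ k =
      (-1) ^ k * X (Sum.inr j) ^ k := fun j => by rw [neg_pow]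
  simp_rw [this, ← Finset.mul_sum]
  ring

lemma DSym_psP (m n k : ℕ) : DSym (psP m n k) := by
  intro σ τ
  simp only [psP, map_add, map_sum, map_mul, map_pow, rename_X, Sum.map_inl, Sum.map_inr, map_neg,
    map_one]
  rw [Equiv.sum_comp σ (fun i => (X (Sum.inl i) : MvPolynomial (Fin m ⊕ Fin n) ℂ) ^ k),
    Equiv.sum_comp τ (fun i => (X (Sum.inr i) : MvPolynomial (Fin m ⊕ Fin n) ℂ) ^ k)]

lemma Cancel_psP (m n k : ℕ) : Cancel (psP m n k) := by
  intro a b i j h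
  simp only [psP_eq, map_sub, map_sum, map_pow, map_neg, eval_X, Sum.elim_inl, Sum.elim_inr]
  rw [← Finset.add_sum_erase _ _ (Finset.mem_univ i), ← Finset.add_sum_erase _ _ (Finset.mem_univ j),
    ← Finset.add_sum_erase _ (fun x => Function.update a i 0 x ^ k) (Finset.mem_univ i),
    ← Finset.add_sum_erase _ (fun x => (-Function.update b j 0 x) ^ k) (Finset.mem_univ j)]
  have e1 : ∑ x ∈ Finset.univ.erase i, Function.update a i 0 x ^ k =
      ∑ x ∈ Finset.univ.erase i, a x ^ k :=
    Finset.sum_congr rfl fun x hx => by rw [Function.update_of_ne (Finset.ne_of_mem_erase hx)]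
  have e2 : ∑ x ∈ Finset.univ.erase j, (- Function.update b j 0 x) ^ k =
      ∑ x ∈ Finset.univ.erase j, (- b x) ^ k :=
    Finset.sum_congr rfl fun x hx => by rw [Function.update_of_ne (Finset.ne_of_mem_erase hx)]
  rw [e1, e2, h, Function.update_self, Function.update_self, neg_zero]
  ring

lemma DSym_Cancel_of_mem {m n : ℕ} {p : MvPolynomial (Fin m ⊕ Fin n) ℂ}
    (hp : p ∈ Algebra.adjoin ℂ (Set.range (psP m n))) : DSym p ∧ Cancel p := by
  induction hp using Algebra.adjoin_induction with
  | mem x hx =>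
    obtain ⟨k, rfl⟩ := hx
    exact ⟨DSym_psP m n k, Cancel_psP m n k⟩
  | algebraMap r => exact ⟨fun σ τ => by simp, fun a b i j h => by rw [algebraMap_eq, eval_C, eval_C]⟩
  | add x y _ _ hx hy =>
    exact ⟨fun σ τ => by rw [map_add, hx.1, hy.1],
      fun a b i j h => by rw [map_add, map_add, hx.2 a b i j h, hy.2 a b i j h]⟩
  | mul x y _ _ hx hy =>
    exact ⟨fun σ τ => by rw [map_mul, hx.1, hy.1],
      fun a b i j h => by rw [map_mul, map_mul, hx.2 a b i j h, hy.2 a b i j h]⟩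

lemma resD_ne_zero (m n : ℕ) : resD m n ≠ 0 := by
  rw [resD, Finset.prod_ne_zero_iff]
  intro ij _ h
  have := congrArg (eval (fun _ => (1 : ℂ))) h
  simp at this

lemma DSym_resD (m n : ℕ) : DSym (resD m n) := by
  intro σ τ
  simp only [resD, map_prod, map_add, rename_X, Sum.map_inl, Sum.map_inr]
  exact Equiv.prod_comp (Equiv.prodCongr σ τ) (fun ij : Fin m × Fin n =>
    (X (Sum.inl ij.1) + X (Sum.inr ij.2) : MvPolynomial (Fin m ⊕ Fin n) ℂ))

/-- The subalgebra contains the products of the resultant with separated symmetric polynomials. -/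
lemma resD_mul_mem (m n : ℕ) (u : MvPolynomial (Fin m) ℂ) (v : MvPolynomial (Fin n) ℂ)
    (hu : u.IsSymmetric) (hv : v.IsSymmetric) :
    resD m n * (aeval (fun i => (X (Sum.inl i) : MvPolynomial (Fin m ⊕ Fin n) ℂ)) u *
      aeval (fun j => (- X (Sum.inr j) : MvPolynomial (Fin m ⊕ Fin n) ℂ)) v) ∈
      Algebra.adjoin ℂ (Set.range (psP m n)) := by
  set A := Algebra.adjoin ℂ (Set.range (psP m n)) with hA
  set x : Fin m → MvPolynomial (Fin m ⊕ Fin n) ℂ := fun i => X (Sum.inl i) with hx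
  set y : Fin n → MvPolynomial (Fin m ⊕ Fin n) ℂ := fun j => - X (Sum.inr j) with hy
  have hxi : Function.Injective x := fun i j h => Sum.inl_injective (X_injective h)
  have hyi : Function.Injective y := fun i j h => Sum.inr_injective (X_injective (neg_injective h))
  have hps : psP m n = fun k : ℕ => ∑ i, x i ^ k - ∑ j, y j ^ k := by
    funext k
    exact psP_eq m n k
  have hy1 : ∀ v : MvPolynomial (Fin n) ℂ, v.IsSymmetric → resD m n * aeval y v ∈ A := by
    intro v hv
    have h := key_mem x y hyi v hv
    rw [← hps, ← hA] at h
    have e : resD m n = (-1) ^ (n * m) * ∏ j, ∏ i, (y j - x i) := by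
      have e1 : ∀ j i, y j - x i = (-1) * (X (Sum.inl i) + X (Sum.inr j)) := by
        intro j i
        simp only [hx, hy]
        ring
      simp_rw [e1, Finset.prod_mul_distrib]
      rw [resD, Fintype.prod_prod_type_right]
      simp only [Finset.prod_const, Finset.card_univ, Fintype.card_fin]
      rw [← pow_mul, ← mul_assoc, ← pow_add, mul_comm m n, Even.neg_one_pow ⟨_, rfl⟩, one_mul]
    rw [e, mul_assoc]
    exact mul_mem (pow_mem (neg_mem (one_mem _)) _) h
  have hxu : aeval x u ∈ Algebra.adjoin ℂ (Set.range fun k : ℕ => ∑ i, x i ^ k) := by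
    have h := key_mem (fun i : Fin 0 => (0 : MvPolynomial (Fin m ⊕ Fin n) ℂ)) x hxi u hu
    simp only [Finset.univ_eq_empty, Finset.prod_empty, Finset.prod_const_one, one_mul,
      Finset.sum_empty, zero_sub] at h
    refine Algebra.adjoin_le ?_ h
    rintro _ ⟨k, rfl⟩
    exact neg_mem (Algebra.subset_adjoin ⟨k, rfl⟩)
  have hmain : ∀ w ∈ Algebra.adjoin ℂ (Set.range fun k : ℕ => ∑ i, x i ^ k),
      ∀ u, (∀ v : MvPolynomial (Fin n) ℂ, v.IsSymmetric → resD m n * (u * aeval y v) ∈ A) →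
        (∀ v : MvPolynomial (Fin n) ℂ, v.IsSymmetric → resD m n * ((w * u) * aeval y v) ∈ A) := by
    intro w hw
    induction hw using Algebra.adjoin_induction with
    | mem w hw =>
      obtain ⟨k, rfl⟩ := hw
      intro u hu v hv
      have h1 := hu v hv
      have h2 := hu (psum (Fin n) ℂ k * v) ((psum_isSymmetric (Fin n) ℂ k).mul hv)
      have h3 : psP m n k ∈ A := Algebra.subset_adjoin ⟨k, rfl⟩
      have e : resD m n * (((∑ i, x i ^ k) * u) * aeval y v) =
          psP m n k * (resD m n * (u * aeval y v)) +
            resD m n * (u * aeval y (psum (Fin n) ℂ k * v)) := by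
        rw [hps, map_mul]
        simp only [psum, map_sum, map_pow, aeval_X]
        ring
      simp only
      rw [e]
      exact add_mem (mul_mem h3 h1) h2
    | algebraMap r =>
      intro u hu v hv
      have := mul_mem (Subalgebra.algebraMap_mem A r) (hu v hv)
      convert this using 1
      ring
    | add w1 w2 _ _ h1 h2 =>
      intro u hu v hv
      have := add_mem (h1 u hu v hv) (h2 u hu v hv)
      convert this using 1
      ring
    | mul w1 w2 _ _ h1 h2 =>
      intro u hu v hv
      have := h1 (w2 * u) (h2 u hu) v hv
      convert this using 1
      ring
  have := hmain _ hxu 1 (fun v hv => by rw [one_mul]; exact hy1 v hv) v hv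
  rwa [mul_one] at this

/-- Symmetrised monomial. -/
noncomputable def symMon {n : ℕ} (c : MvPolynomial (Fin n) ℂ) (l : Fin n → ℕ) :
    MvPolynomial (Fin n) ℂ :=
  ∑ σ : Equiv.Perm (Fin n), ∏ i, (c * X (σ i)) ^ l i

lemma symMon_symm {n : ℕ} (c : MvPolynomial (Fin n) ℂ) (hc : c.IsSymmetric) (l : Fin n → ℕ) :
    (symMon c l).IsSymmetric := by
  intro e
  simp only [symMon, map_sum, map_prod, map_pow, map_mul, rename_X, hc e]
  exact Equiv.sum_comp (Equiv.mulLeft e) (fun σ : Equiv.Perm (Fin n) =>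
    ∏ i, (c * X (σ i)) ^ l i)

lemma resD_mul_mem' {m n : ℕ} (h : MvPolynomial (Fin m ⊕ Fin n) ℂ) (hs : DSym h) :
    resD m n * h ∈ Algebra.adjoin ℂ (Set.range (psP m n)) := by
  set A := Algebra.adjoin ℂ (Set.range (psP m n)) with hA
  have h1 : ∑ σ : Equiv.Perm (Fin m), ∑ τ : Equiv.Perm (Fin n), rename (Sum.map σ τ) h =
      ((m.factorial * n.factorial : ℕ) : ℂ) • h := by
    rw [Finset.sum_congr rfl fun σ _ => Finset.sum_congr rfl fun τ _ => hs σ τ]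
    simp [Fintype.card_perm, smul_eq_C_mul, mul_assoc]
  have h2 : ∑ σ : Equiv.Perm (Fin m), ∑ τ : Equiv.Perm (Fin n), rename (Sum.map σ τ) h =
      ∑ l ∈ h.support, C (h.coeff l) *
        (aeval (fun i => (X (Sum.inl i) : MvPolynomial (Fin m ⊕ Fin n) ℂ))
          (symMon 1 fun i => l (Sum.inl i)) *
        aeval (fun j => (- X (Sum.inr j) : MvPolynomial (Fin m ⊕ Fin n) ℂ))
          (symMon (-1) fun i => l (Sum.inr i))) := by
    have : ∀ (σ : Equiv.Perm (Fin m)) (τ : Equiv.Perm (Fin n)), rename (Sum.map σ τ) h =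
        ∑ l ∈ h.support, C (h.coeff l) * ((∏ i, X (Sum.inl (σ i)) ^ l (Sum.inl i)) *
          ∏ j, X (Sum.inr (τ j)) ^ l (Sum.inr j)) := by
      intro σ τ
      rw [rename_eq_aeval, aeval_def, eval₂_eq']
      simp [Fintype.prod_sum_type]
    simp_rw [this]
    have e : ∀ σ : Equiv.Perm (Fin m), ∑ τ : Equiv.Perm (Fin n), 
        ∑ l ∈ h.support, C (h.coeff l) * ((∏ i, X (Sum.inl (σ i)) ^ l (Sum.inl i)) *
          ∏ j, X (Sum.inr (τ j)) ^ l (Sum.inr j)) = 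
        ∑ l ∈ h.support, ∑ τ : Equiv.Perm (Fin n), 
         (C (h.coeff l) * ((∏ i, X (Sum.inl (σ i)) ^ l (Sum.inl i)) *
          ∏ j, X (Sum.inr (τ j)) ^ l (Sum.inr j)) : MvPolynomial (Fin m ⊕ Fin n) ℂ) := 
      fun σ => Finset.sum_comm
    simp_rw [e]
    rw [Finset.sum_comm]
    refine Finset.sum_congr rfl fun l _ => ?_
    simp only [symMon, map_sum, map_prod, map_pow, map_mul, aeval_X, map_one, map_neg, one_mul,
      neg_mul_neg]
    rw [Finset.sum_mul_sum]
    simp only [Finset.mul_sum]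
  have h3 : resD m n * h = (((m.factorial * n.factorial : ℕ) : ℂ)⁻¹) •
      (resD m n * (((m.factorial * n.factorial : ℕ) : ℂ) • h)) := by
    rw [mul_smul_comm, smul_smul, inv_mul_cancel₀, one_smul]
    exact_mod_cast mul_ne_zero m.factorial_ne_zero n.factorial_ne_zero
  rw [h3, ← h1, h2, Finset.mul_sum]
  refine Subalgebra.smul_mem _ (sum_mem fun l _ => ?_) _
  rw [mul_left_comm]
  refine mul_mem (Subalgebra.algebraMap_mem A _) (resD_mul_mem m n _ _ (symMon_symm _ ?_ _)
    (symMon_symm _ ?_ _))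
  · intro e; simp
  · intro e; simp

/-- The substitution `x_i ↦ -y_j`. -/
noncomputable def subIJ {m n : ℕ} (i : Fin m) (j : Fin n) :
    MvPolynomial (Fin m ⊕ Fin n) ℂ →ₐ[ℂ] MvPolynomial (Fin m ⊕ Fin n) ℂ :=
  aeval fun z => if z = Sum.inl i then - X (Sum.inr j) else X z

lemma dvd_sub_subIJ {m n : ℕ} (i : Fin m) (j : Fin n) (p : MvPolynomial (Fin m ⊕ Fin n) ℂ) :
    (X (Sum.inl i) + X (Sum.inr j)) ∣ p - subIJ i j p := by
  induction p using MvPolynomial.induction_on with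
  | C a => simp [subIJ]
  | add p q hp hq =>
    rw [map_add, add_sub_add_comm]
    exact dvd_add hp hq
  | mul_X p z hp =>
    rw [map_mul]
    have hz : (X (Sum.inl i) + X (Sum.inr j)) ∣ (X z - subIJ i j (X z)) := by
      simp only [subIJ, aeval_X]
      split_ifs with h
      · rw [h, sub_neg_eq_add]
      · simp
    have : p * X z - subIJ i j p * subIJ i j (X z) =
      (p - subIJ i j p) * X z + subIJ i j p * (X z - subIJ i j (X z)) := by ring
    rw [this]
    exact dvd_add (hp.mul_right _) (hz.mul_left _)

lemma subIJ_ne_zero {m n : ℕ} (i k : Fin m) (j l : Fin n) (h : (k, l) ≠ (i, j)) :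
    subIJ i j (X (Sum.inl k) + X (Sum.inr l)) ≠ 0 := by
  intro h0
  have := congrArg (eval (fun z => if z = Sum.inr j then (-1 : ℂ) else 3)) h0
  simp only [subIJ, map_add, aeval_X, map_zero] at this
  by_cases hk : k = i <;> by_cases hl : l = j
  · exact h (by rw [hk, hl])
  all_goals
    simp [hk, hl] at this
    try norm_num at this

lemma resD_dvd {m n : ℕ} (g : MvPolynomial (Fin m ⊕ Fin n) ℂ) (hg : ∀ i j, subIJ i j g = 0) :
    resD m n ∣ g := by
  classical
  have : ∀ S : Finset (Fin m × Fin n),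
      (∏ ij ∈ S, (X (Sum.inl ij.1) + X (Sum.inr ij.2)) : MvPolynomial (Fin m ⊕ Fin n) ℂ) ∣ g := by
    intro S
    induction S using Finset.induction_on with
    | empty => simp
    | insert ij S hij ih =>
      obtain ⟨h, hh⟩ := ih
      obtain ⟨i, j⟩ := ij
      have h0 := hg i j
      rw [hh, map_mul, map_prod] at h0
      have h1 : subIJ i j h = 0 := by
        refine (mul_eq_zero.1 h0).resolve_left ?_
        refine Finset.prod_ne_zero_iff.2 ?_
        rintro ⟨k, l⟩ hkl
        exact subIJ_ne_zero i k j l (fun e => hij (e ▸ hkl))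
      have h2 := dvd_sub_subIJ i j h
      rw [h1, sub_zero] at h2
      rw [Finset.prod_insert hij, hh, mul_comm]
      exact mul_dvd_mul_left _ h2
  exact this Finset.univ

lemma DSym_of_resD_mul {m n : ℕ} (h : MvPolynomial (Fin m ⊕ Fin n) ℂ) (hg : DSym (resD m n * h)) :
    DSym h := by
  intro σ τ
  have := hg σ τ
  rw [map_mul, DSym_resD m n σ τ] at this
  exact mul_left_cancel₀ (resD_ne_zero m n) this

lemma DSym.eval {m n : ℕ} {p : MvPolynomial (Fin m ⊕ Fin n) ℂ} (hp : DSym p) (a : Fin m → ℂ)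
    (b : Fin n → ℂ) (σ : Equiv.Perm (Fin m)) (τ : Equiv.Perm (Fin n)) :
    eval (Sum.elim (a ∘ σ) (b ∘ τ)) p = eval (Sum.elim a b) p := by
  conv_rhs => rw [← hp σ τ, eval_rename, Sum.elim_comp_map]

/-- Setting the first variables to zero. -/
noncomputable def theta (m n : ℕ) :
    MvPolynomial (Fin (m + 1) ⊕ Fin (n + 1)) ℂ →ₐ[ℂ] MvPolynomial (Fin m ⊕ Fin n) ℂ :=
  aeval (Sum.elim (Fin.cons 0 fun i => X (Sum.inl i)) (Fin.cons 0 fun j => X (Sum.inr j)))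

lemma eval_theta (m n : ℕ) (p : MvPolynomial (Fin (m + 1) ⊕ Fin (n + 1)) ℂ) (a : Fin m → ℂ)
    (b : Fin n → ℂ) : eval (Sum.elim a b) (theta m n p) =
      eval (Sum.elim (Fin.cons 0 a : Fin (m + 1) → ℂ) (Fin.cons 0 b : Fin (n + 1) → ℂ)) p := by
  induction p using MvPolynomial.induction_on with
  | C a => simp [theta]
  | add p q hp hq => simp only [map_add, hp, hq]
  | mul_X p z hp =>
    rw [map_mul, map_mul, map_mul, hp]
    congr 1
    rcases z with z | z <;> refine Fin.cases ?_ (fun z => ?_) z <;> simp [theta]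

lemma theta_psP (m n k : ℕ) : theta m n (psP (m + 1) (n + 1) k) = psP m n k := by
  rw [psP_eq, psP_eq, Fin.sum_univ_succ, Fin.sum_univ_succ]
  simp only [map_sub, map_add, map_sum, map_pow, map_neg, theta, aeval_X, Sum.elim_inl,
    Sum.elim_inr, Fin.cons_zero, Fin.cons_succ]
  ring

lemma ext_eval {m n : ℕ} {p q : MvPolynomial (Fin m ⊕ Fin n) ℂ}
    (h : ∀ a b, eval (Sum.elim a b) p = eval (Sum.elim a b) q) : p = q := by
  apply MvPolynomial.funext
  intro f
  rw [← Sum.elim_comp_inl_inr f]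
  exact h _ _

lemma cons_comp {m : ℕ} (a : Fin m → ℂ) (σ : Equiv.Perm (Fin m)) :
    (Fin.cons 0 (a ∘ σ) : Fin (m + 1) → ℂ) =
      (Fin.cons 0 a : Fin (m + 1) → ℂ) ∘ (Equiv.Perm.decomposeFin.symm (0, σ)) := by
  funext i
  refine Fin.cases ?_ (fun i => ?_) i <;> simp

lemma DSym_theta {m n : ℕ} {p : MvPolynomial (Fin (m + 1) ⊕ Fin (n + 1)) ℂ} (hp : DSym p) :
    DSym (theta m n p) := by
  intro σ τ
  apply ext_eval
  intro a b
  rw [eval_rename, Sum.elim_comp_map, eval_theta, eval_theta, cons_comp, cons_comp, hp.eval]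

lemma Cancel_theta {m n : ℕ} {p : MvPolynomial (Fin (m + 1) ⊕ Fin (n + 1)) ℂ} (hp : Cancel p) :
    Cancel (theta m n p) := by
  intro a b i j h
  rw [eval_theta, eval_theta, hp _ _ i.succ j.succ (by simpa using h), ← Fin.cons_update,
    ← Fin.cons_update]

lemma mem_of_subIJ {m n : ℕ} (p : MvPolynomial (Fin m ⊕ Fin n) ℂ) (hp : DSym p)
    (h : ∀ i j, subIJ i j p = 0) : p ∈ Algebra.adjoin ℂ (Set.range (psP m n)) := by
  obtain ⟨q, rfl⟩ := resD_dvd p h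
  exact resD_mul_mem' q (DSym_of_resD_mul q hp)

lemma eval_subIJ {m n : ℕ} (i : Fin m) (j : Fin n) (p : MvPolynomial (Fin m ⊕ Fin n) ℂ)
    (a : Fin m → ℂ) (b : Fin n → ℂ) :
    eval (Sum.elim a b) (subIJ i j p) = eval (Sum.elim (Function.update a i (- b j)) b) p := by
  induction p using MvPolynomial.induction_on with
  | C a => simp only [subIJ, algHom_C, algebraMap_eq, eval_C]
  | add p q hp hq => simp only [map_add, hp, hq]
  | mul_X p z hp =>
    rw [map_mul, map_mul, map_mul, hp]
    congr 1
    rcases z with z | z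
    · by_cases hz : z = i
      · subst hz; simp [-Sum.update_elim_inl, -Sum.update_elim_inr, -Sum.elim_update_left, -Sum.elim_update_right, subIJ]
      · simp [-Sum.update_elim_inl, -Sum.update_elim_inr, -Sum.elim_update_left, -Sum.elim_update_right, subIJ, hz]
    · simp [-Sum.update_elim_inl, -Sum.update_elim_inr, -Sum.elim_update_left, -Sum.elim_update_right, subIJ]

lemma update_swap {m : ℕ} (a : Fin m → ℂ) (i k : Fin m) (c : ℂ) :
    Function.update a i c ∘ Equiv.swap i k = Function.update (a ∘ Equiv.swap i k) k c := by
  funext z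
  by_cases hz : z = k
  · subst hz; simp
  · rw [Function.update_of_ne hz, Function.comp, Function.update_of_ne, Function.comp]
    intro h
    apply hz
    rw [← Equiv.swap_apply_self i k z, h, Equiv.swap_apply_left]

lemma mem_of_DSym_Cancel (m n : ℕ) (p : MvPolynomial (Fin m ⊕ Fin n) ℂ) (hp : DSym p)
    (hc : Cancel p) : p ∈ Algebra.adjoin ℂ (Set.range (psP m n)) := by
  induction m generalizing n with
  | zero => exact mem_of_subIJ p hp fun i => i.elim0
  | succ m ih =>
    cases n with
    | zero => exact mem_of_subIJ p hp fun _ j => j.elim0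
    | succ n =>
      have h1 := ih n (theta m n p) (DSym_theta hp) (Cancel_theta hc)
      have h2 : ∃ q ∈ Algebra.adjoin ℂ (Set.range (psP (m + 1) (n + 1))),
          theta m n q = theta m n p := by
        have : Set.range (psP m n) = theta m n '' Set.range (psP (m + 1) (n + 1)) := by
          rw [← Set.range_comp]
          congr 1
          funext k
          exact (theta_psP m n k).symm
        rw [this, ← AlgHom.map_adjoin] at h1
        exact h1
      obtain ⟨q, hq, hqp⟩ := h2
      obtain ⟨hqs, hqc⟩ := DSym_Cancel_of_mem hq
      have hs : DSym (p - q) := fun σ τ => by rw [map_sub, hp, hqs]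
      have h3 : p - q ∈ Algebra.adjoin ℂ (Set.range (psP (m + 1) (n + 1))) := by
        refine mem_of_subIJ _ hs fun i j => ext_eval fun a b => ?_
        have hcc : Cancel (p - q) := fun a b i j h => by
          rw [map_sub, map_sub, hc a b i j h, hqc a b i j h]
        rw [eval_subIJ, hcc _ _ i j (by simp), map_zero, Function.update_idem,
          ← hs.eval _ _ (Equiv.swap i 0) (Equiv.swap j 0), update_swap, update_swap]
        have hcons : ∀ {r : ℕ} (a : Fin (r + 1) → ℂ), Function.update a 0 0 =
            (Fin.cons 0 (Fin.tail a) : Fin (r + 1) → ℂ) := by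
          intro r a
          conv_lhs => rw [← Fin.cons_self_tail a, Fin.update_cons_zero]
        rw [hcons, hcons, ← eval_theta, map_sub, hqp, sub_self, map_zero]
      have := add_mem h3 hq
      rwa [sub_add_cancel] at this

lemma eval_cancelSub (r s : ℕ) (t : ℂ) (p : MvPolynomial (Fin (r + 1) ⊕ Fin (s + 1)) ℂ)
    (a : Fin (r + 1) → ℂ) (b : Fin (s + 1) → ℂ) :
    eval (Sum.elim a b) (cancelSub r s t p) =
      eval (Sum.elim (Function.update a (Fin.last r) t) (Function.update b 0 (-t))) p := by
  induction p using MvPolynomial.induction_on with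
  | C a => simp only [cancelSub, algHom_C, algebraMap_eq, eval_C]
  | add p q hp hq => simp only [map_add, hp, hq]
  | mul_X p z hp =>
    rw [map_mul, map_mul, map_mul, hp]
    congr 1
    rcases z with z | z
    · by_cases hz : z = Fin.last r
      · subst hz; simp [-Sum.update_elim_inl, -Sum.update_elim_inr, -Sum.elim_update_left, -Sum.elim_update_right, cancelSub]
      · simp [-Sum.update_elim_inl, -Sum.update_elim_inr, -Sum.elim_update_left, -Sum.elim_update_right, cancelSub, hz]
    · by_cases hz : z = 0
      · subst hz; simp [-Sum.update_elim_inl, -Sum.update_elim_inr, -Sum.elim_update_left, -Sum.elim_update_right, cancelSub]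
      · simp [-Sum.update_elim_inl, -Sum.update_elim_inr, -Sum.elim_update_left, -Sum.elim_update_right, cancelSub, hz]

end main

/-- A doubly symmetric polynomial is supersymmetric (i.e. satisfies the cancellation property)
iff it lies in the `ℂ`-subalgebra generated by the power sum supersymmetric polynomials. -/
theorem supersymmetric_iff_mem_adjoin_powerSums (r s : ℕ)
    (p : MvPolynomial (Fin (r + 1) ⊕ Fin (s + 1)) ℂ)
    (hx : ∀ σ : Equiv.Perm (Fin (r + 1)),
      MvPolynomial.rename (Sum.map (σ : Fin (r + 1) → Fin (r + 1)) id) p = p)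
    (hy : ∀ τ : Equiv.Perm (Fin (s + 1)),
      MvPolynomial.rename (Sum.map id (τ : Fin (s + 1) → Fin (s + 1))) p = p) :
    (∀ t t' : ℂ, cancelSub r s t p = cancelSub r s t' p) ↔
      p ∈ Algebra.adjoin ℂ (Set.range (powerSumSupersym r s)) := by
  have hps : powerSumSupersym r s = psP (r + 1) (s + 1) := rfl
  rw [hps]
  have hs : DSym p := by
    intro σ τ
    have e : (Sum.map σ τ : Fin (r + 1) ⊕ Fin (s + 1) → Fin (r + 1) ⊕ Fin (s + 1)) =
        Sum.map σ id ∘ Sum.map id τ := by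
      rw [Sum.map_comp_map]; rfl
    rw [e, ← rename_rename, hy, hx]
  constructor
  · intro h
    refine mem_of_DSym_Cancel _ _ p hs fun a b i j hab => ?_
    have h1 := congrArg (eval (Sum.elim (a ∘ Equiv.swap i (Fin.last r)) (b ∘ Equiv.swap j 0)))
      (h (a i) 0)
    rw [eval_cancelSub, eval_cancelSub, ← update_swap, ← update_swap, ← update_swap, ← update_swap,
      hs.eval, hs.eval] at h1
    have e : - a i = b j := by rw [hab, neg_neg]
    rwa [e, Function.update_eq_self, Function.update_eq_self, neg_zero] at h1
  · intro h t t'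
    have hc := (DSym_Cancel_of_mem h).2
    refine ext_eval fun a b => ?_
    rw [eval_cancelSub, eval_cancelSub, hc _ _ (Fin.last r) 0 (by simp)]
    conv_rhs => rw [hc _ _ (Fin.last r) 0 (by simp)]
    simp only [Function.update_idem]
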